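/- Let A be a signed graph on n vertices and let 1 ≤ k ≤ n. Then the matrix Alt_{n,k} * (Alt_{n,k})ᵀ commutes with the k-fold Cartesian product matrix A^{□k}, i.e. (Alt_{n,k} * (Alt_{n,k})ᵀ) * A^{□k} = A^{□k} * (Alt_{n,k} * (Alt_{n,k})ᵀ). -/

import Mathlib

open Matrix Finset

def IsSignedMatrix {ι : Type*} (B : Matrix ι ι ℝ) : Prop :=
  B.IsSymm ∧ (∀ i, B i i = 0) ∧ ∀ i j, B i j = -1 ∨ B i j = 0 ∨ B i j = 1

def IsBalancedMatrix {ι : Type*} [Fintype ι] (B : Matrix ι ι ℝ) : Prop :=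
  ∃ D : Matrix ι ι ℝ, D.IsDiag ∧ (∀ i, D i i = 1 ∨ D i i = -1) ∧
    D * B * D = Matrix.of fun i j => |B i j|

def cartPow {n : ℕ} (A : Matrix (Fin n) (Fin n) ℝ) (k : ℕ) :
    Matrix (Fin k → Fin n) (Fin k → Fin n) ℝ :=
  Matrix.of fun u v => ∑ i : Fin k, A (u i) (v i) *
    ∏ j ∈ Finset.univ.erase i, (if u j = v j then (1 : ℝ) else 0)

noncomputable def enumOf {n k : ℕ} (r : LinearOrder (Fin n)) (S : Finset (Fin n))
    (h : S.card = k) : Fin k → Fin n :=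
  fun i => ((@Finset.orderIsoOfFin (Fin n) r S k h) i : Fin n)

noncomputable def altOf {n : ℕ} (k : ℕ) (r : LinearOrder (Fin n)) :
    Matrix (Fin k → Fin n) {S : Finset (Fin n) // S.card = k} ℝ :=
  Matrix.of fun u S =>
    (Real.sqrt (Nat.factorial k))⁻¹ *
      ∑ π : Equiv.Perm (Fin k),
        if u = enumOf r S.1 S.2 ∘ π then ((Equiv.Perm.sign π : ℤ) : ℝ) else 0

noncomputable def alt (n k : ℕ) :
    Matrix (Fin k → Fin n) {S : Finset (Fin n) // S.card = k} ℝ :=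
  altOf k inferInstance

noncomputable def extPow {n : ℕ} (A : Matrix (Fin n) (Fin n) ℝ) (k : ℕ) :
    Matrix {S : Finset (Fin n) // S.card = k} {S : Finset (Fin n) // S.card = k} ℝ :=
  (alt n k)ᵀ * cartPow A k * alt n k

def IsPathMatrix {n : ℕ} (A : Matrix (Fin n) (Fin n) ℝ) : Prop :=
  ∃ g : Equiv.Perm (Fin n), ∀ i j : Fin n,
    |A (g i) (g j)| = 1 ↔ ((i : ℤ) - j = 1 ∨ (j : ℤ) - i = 1)

def IsCycleMatrix {n : ℕ} (A : Matrix (Fin n) (Fin n) ℝ) : Prop :=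
  3 ≤ n ∧ ∃ g : Equiv.Perm (Fin n), ∀ i j : Fin n,
    |A (g i) (g j)| = 1 ↔
      ((i : ℤ) - j ≡ 1 [ZMOD (n : ℤ)] ∨ (i : ℤ) - j ≡ -1 [ZMOD (n : ℤ)])

def signedAdjGraph {n : ℕ} (A : Matrix (Fin n) (Fin n) ℝ) : SimpleGraph (Fin n) :=
  SimpleGraph.fromRel (fun u v => |A u v| = 1)

/-- The sign-weighted count of the permutations of the coordinates carrying `u` to `v`. -/
noncomputable def signedTransport {ι α : Type*} [Fintype ι] [DecidableEq ι] [DecidableEq α]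
    (u v : ι → α) : ℝ :=
  ∑ τ : Equiv.Perm ι, if v = u ∘ τ then ((Equiv.Perm.sign τ : ℤ) : ℝ) else 0

theorem signedTransport_comp_perm {ι α : Type*} [Fintype ι] [DecidableEq ι] [DecidableEq α]
    (u v : ι → α) (σ : Equiv.Perm ι) :
    signedTransport (u ∘ σ) v = ((Equiv.Perm.sign σ : ℤ) : ℝ) * signedTransport u v := by
  unfold signedTransport
  rw [Finset.mul_sum, ← Equiv.sum_comp (Equiv.mulLeft σ)
    (fun τ => ((Equiv.Perm.sign σ : ℤ) : ℝ) *
      if v = u ∘ τ then ((Equiv.Perm.sign τ : ℤ) : ℝ) else 0)]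
  refine Finset.sum_congr rfl fun τ _ => ?_
  have hs : ((Equiv.Perm.sign σ : ℤ) : ℝ) * ((Equiv.Perm.sign σ : ℤ) : ℝ) = 1 := by
    rcases Int.units_eq_one_or (Equiv.Perm.sign σ) with h | h <;> simp [h]
  have hc : u ∘ (Equiv.mulLeft σ τ : Equiv.Perm ι) = (u ∘ σ) ∘ τ := rfl
  rw [hc]
  split_ifs
  · simp only [Equiv.coe_mulLeft, Equiv.Perm.sign_mul, Units.val_mul, Int.cast_mul]
    rw [← mul_assoc, hs, one_mul]
  · simp

theorem signedTransport_eq_zero {ι α : Type*} [Fintype ι] [DecidableEq ι] [DecidableEq α]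
    {u : ι → α} (hu : ¬ Function.Injective u) (v : ι → α) : signedTransport u v = 0 := by
  simp only [Function.Injective, not_forall] at hu
  obtain ⟨i, j, hij, hne⟩ := hu
  have h := signedTransport_comp_perm u v (Equiv.swap i j)
  have hsw : u ∘ Equiv.swap i j = u := by
    funext x
    rcases eq_or_ne x i with rfl | hi
    · simp [hij]
    · rcases eq_or_ne x j with rfl | hj
      · simp [hij]
      · simp [Equiv.swap_apply_of_ne_of_ne hi hj]
  rw [hsw, Equiv.Perm.sign_swap hne] at h
  push_cast at h
  linarith

theorem enumOf_injective {n k : ℕ} (r : LinearOrder (Fin n)) (S : Finset (Fin n))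
    (h : S.card = k) : Function.Injective (enumOf r S h) := fun _ _ hij =>
  (@Finset.orderIsoOfFin (Fin n) r S k h).toEquiv.injective (Subtype.ext hij)

theorem range_enumOf {n k : ℕ} (r : LinearOrder (Fin n)) (S : Finset (Fin n))
    (h : S.card = k) : Set.range (enumOf r S h) = S := by
  ext x
  constructor
  · rintro ⟨i, rfl⟩
    exact (@Finset.orderIsoOfFin (Fin n) r S k h i).2
  · intro hx
    obtain ⟨i, hi⟩ := (@Finset.orderIsoOfFin (Fin n) r S k h).toEquiv.surjective ⟨x, hx⟩
    exact ⟨i, congrArg Subtype.val hi⟩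

theorem altOf_apply {n k : ℕ} (r : LinearOrder (Fin n)) (u : Fin k → Fin n)
    (S : {S : Finset (Fin n) // S.card = k}) :
    altOf k r u S = (Real.sqrt (Nat.factorial k))⁻¹ * signedTransport (enumOf r S.1 S.2) u :=
  rfl

theorem signedTransport_enumOf_eq_zero {n k : ℕ} (r : LinearOrder (Fin n)) {u : Fin k → Fin n}
    (S : Finset (Fin n)) (hS : S.card = k)
    (h : ¬ (Function.Injective u ∧ Set.range u = S)) :
    signedTransport (enumOf r S hS) u = 0 := by
  refine Finset.sum_eq_zero fun π _ => if_neg ?_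
  rintro rfl
  refine h ⟨(enumOf_injective r S hS).comp π.injective, ?_⟩
  rw [EquivLike.range_comp, range_enumOf]

theorem signedTransport_comp_perm_right_self {ι α : Type*} [Fintype ι] [DecidableEq ι]
    [DecidableEq α] {e : ι → α} (he : Function.Injective e) (π : Equiv.Perm ι) :
    signedTransport e (e ∘ π) = ((Equiv.Perm.sign π : ℤ) : ℝ) := by
  unfold signedTransport
  rw [Finset.sum_eq_single π]
  · simp
  · intro σ _ hσ
    refine if_neg fun h => hσ ?_
    exact Equiv.ext fun i => (he (congrFun h i)).symm
  · simp

theorem exists_eq_enumOf_comp {n k : ℕ} (r : LinearOrder (Fin n)) {u : Fin k → Fin n}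
    (hu : Function.Injective u) (S : Finset (Fin n)) (hS : S.card = k)
    (h : Set.range u = S) : ∃ π : Equiv.Perm (Fin k), u = enumOf r S hS ∘ π := by
  have hmem : ∀ i, ∃ j, enumOf r S hS j = u i := fun i => by
    change u i ∈ Set.range (enumOf r S hS)
    rw [range_enumOf, ← h]
    exact Set.mem_range_self i
  choose f hf using hmem
  have hfi : Function.Injective f := fun i j hij => hu (by rw [← hf i, ← hf j, hij])
  exact ⟨Equiv.ofBijective f (Finite.injective_iff_bijective.mp hfi), funext fun i => (hf i).symm⟩

/-- The projection `Alt * Altᵀ` is the normalized antisymmetrization operator. -/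
theorem altOf_mul_transpose_apply {n k : ℕ} (r : LinearOrder (Fin n)) (u v : Fin k → Fin n) :
    (altOf k r * (altOf k r)ᵀ) u v = (Nat.factorial k : ℝ)⁻¹ * signedTransport u v := by
  simp only [Matrix.mul_apply, Matrix.transpose_apply, altOf_apply]
  by_cases hu : Function.Injective u
  · have hcard : (Finset.univ.image u).card = k := by
      simp [Finset.card_image_of_injective _ hu]
    have hrange : Set.range u = (Finset.univ.image u : Finset (Fin n)) := by simp
    rw [Finset.sum_eq_single ⟨Finset.univ.image u, hcard⟩]
    · obtain ⟨π, hπ⟩ := exists_eq_enumOf_comp r hu _ hcard hrange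
      have hl := signedTransport_comp_perm_right_self (enumOf_injective r _ hcard) π
      have hr := signedTransport_comp_perm (enumOf r _ hcard) v π
      rw [← hπ] at hl hr
      have hsq : (Real.sqrt (Nat.factorial k))⁻¹ * (Real.sqrt (Nat.factorial k))⁻¹ =
          (Nat.factorial k : ℝ)⁻¹ := by
        rw [← mul_inv, Real.mul_self_sqrt (Nat.cast_nonneg _)]
      rw [hl, hr, ← hsq]
      ring
    · intro S _ hne
      rw [signedTransport_enumOf_eq_zero r S.1 S.2]
      · simp
      · rintro ⟨-, h⟩
        exact hne (Subtype.ext (Finset.coe_injective (h.symm.trans hrange)))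
    · simp
  · rw [signedTransport_eq_zero hu, mul_zero]
    refine Finset.sum_eq_zero fun S _ => ?_
    rw [signedTransport_enumOf_eq_zero r S.1 S.2 fun h => hu h.1]
    simp

theorem cartPow_comp_perm {n k : ℕ} (A : Matrix (Fin n) (Fin n) ℝ) (u v : Fin k → Fin n)
    (τ : Equiv.Perm (Fin k)) : cartPow A k (u ∘ τ) (v ∘ τ) = cartPow A k u v := by
  simp only [cartPow, Matrix.of_apply, Function.comp_apply]
  rw [← Equiv.sum_comp τ (fun i => A (u i) (v i) *
    ∏ j ∈ Finset.univ.erase i, (if u j = v j then (1 : ℝ) else 0))]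
  refine Finset.sum_congr rfl fun i _ => congrArg _ ?_
  refine Finset.prod_bij (fun j _ => τ j) ?_ (fun _ _ _ _ h => τ.injective h) ?_ fun _ _ => rfl
  · simp
  · intro j hj
    refine ⟨τ.symm j, ?_, by simp⟩
    simp only [Finset.mem_erase, Finset.mem_univ, and_true] at hj ⊢
    rintro rfl
    simp at hj

theorem sum_signedTransport_mul_cartPow {n k : ℕ} (A : Matrix (Fin n) (Fin n) ℝ)
    (u v : Fin k → Fin n) :
    ∑ w, signedTransport u w * cartPow A k w v =
      ∑ w, cartPow A k u w * signedTransport w v := by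
  simp only [signedTransport, Finset.sum_mul, Finset.mul_sum]
  rw [Finset.sum_comm, Finset.sum_comm (s := (Finset.univ : Finset (Fin k → Fin n)))]
  refine Finset.sum_congr rfl fun τ _ => ?_
  have hv : ∀ w : Fin k → Fin n, v = w ∘ τ ↔ w = v ∘ τ.symm := fun w =>
    ((Equiv.comp_symm_eq τ w v).symm.trans eq_comm)
  have hc : cartPow A k (u ∘ τ) v = cartPow A k u (v ∘ τ.symm) := by
    rw [← cartPow_comp_perm A u (v ∘ τ.symm) τ]
    congr 1
    funext i
    simp
  simp only [hv, ite_mul, zero_mul, mul_ite, mul_zero, Finset.sum_ite_eq', Finset.mem_univ,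
    if_true]
  rw [hc, mul_comm]

theorem stmt3 {n k : ℕ} (hk : 1 ≤ k) (hkn : k ≤ n)
    (A : Matrix (Fin n) (Fin n) ℝ) (hA : IsSignedMatrix A) :
    (alt n k * (alt n k)ᵀ) * cartPow A k = cartPow A k * (alt n k * (alt n k)ᵀ) := by
  have hP : ∀ u v, (alt n k * (alt n k)ᵀ) u v = (Nat.factorial k : ℝ)⁻¹ * signedTransport u v :=
    altOf_mul_transpose_apply _
  ext u v
  rw [Matrix.mul_apply, Matrix.mul_apply]
  simp only [hP]
  simp only [mul_assoc, mul_left_comm _ ((Nat.factorial k : ℝ)⁻¹), ← Finset.mul_sum]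
  rw [sum_signedTransport_mul_cartPow]
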